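/- arXiv:2105.02360 — 7 statements merged into one kernel-verified Lean document; each statement's English description precedes it below -/
import Mathlib

section
/- Let n ≥ 2, let y₁,…,yₙ ∈ ℝ³ be distinct points, let α ∈ ℝⁿ, and let λ > 0. Set α∘ := min_{1≤i≤n} αᵢ and d := min_{i≠j} ‖yᵢ−yⱼ‖. Then for every ξ ∈ ℝⁿ one has ⟨ξ, M_λ ξ⟩ ≥ (α∘ + √λ/(4π) − (n−1)·e^{−√λ·d}/(4π·d))·‖ξ‖². -/
open Real Matrix

/-- A quadratic form whose diagonal coefficients are at least `a` and whose off-diagonal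
coefficients are at most `b` in absolute value is at least `a - (n - 1) b` times the squared
Euclidean norm. -/
theorem Matrix.sub_card_sub_one_mul_sum_sq_le_dotProduct_mulVec {ι : Type*} [Fintype ι]
    {M : Matrix ι ι ℝ} {a b : ℝ}
    (hdiag : ∀ i, a ≤ M i i) (hoff : ∀ i j, i ≠ j → |M i j| ≤ b) (ξ : ι → ℝ) :
    (a - ((Fintype.card ι : ℝ) - 1) * b) * (∑ i, ξ i ^ 2) ≤ ξ ⬝ᵥ M.mulVec ξ := by
  classical
  have entry_bound : ∀ i j, (if i = j then (a + b) * ξ i ^ 2 else 0) - b / 2 * (ξ i ^ 2 + ξ j ^ 2)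
      ≤ ξ i * (M i j * ξ j) := by
    intro i j
    split_ifs with h
    · subst h
      nlinarith [mul_le_mul_of_nonneg_right (hdiag i) (sq_nonneg (ξ i))]
    · obtain ⟨h₁, h₂⟩ := abs_le.mp (hoff i j h)
      nlinarith [mul_nonneg (sub_nonneg.mpr h₂) (sq_nonneg (ξ i - ξ j)),
        mul_nonneg (neg_le_iff_add_nonneg.mp h₁) (sq_nonneg (ξ i + ξ j))]
  calc (a - ((Fintype.card ι : ℝ) - 1) * b) * (∑ i, ξ i ^ 2)
      = ∑ i, ∑ j, ((if i = j then (a + b) * ξ i ^ 2 else 0)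
          - b / 2 * (ξ i ^ 2 + ξ j ^ 2)) := by
        simp only [Finset.sum_sub_distrib, Finset.sum_ite_eq, Finset.mem_univ, if_true,
          ← Finset.mul_sum, Finset.sum_add_distrib, Finset.sum_const, Finset.card_univ,
          nsmul_eq_mul]
        ring
    _ ≤ ∑ i, ∑ j, ξ i * (M i j * ξ j) :=
        Finset.sum_le_sum fun i _ => Finset.sum_le_sum fun j _ => entry_bound i j
    _ = ξ ⬝ᵥ M.mulVec ξ := by simp only [dotProduct, mulVec, Finset.mul_sum]

/-- The Yukawa kernel `e^{-s r} / (4 π r)` is antitone in the distance `r`. -/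
theorem exp_neg_mul_div_le_of_le {s d r : ℝ} (hs : 0 ≤ s) (hd : 0 < d) (hdr : d ≤ r) :
    Real.exp (-(s * r)) / (4 * Real.pi * r) ≤ Real.exp (-(s * d)) / (4 * Real.pi * d) := by
  have := Real.pi_pos
  gcongr

/-- For distinct points `y₁,…,yₙ ∈ ℝ³`, `α ∈ ℝⁿ` and `λ > 0`, with `α∘ = min αᵢ` and
`d = min_{i≠j} ‖yᵢ−yⱼ‖`, the quadratic form of the matrix `M_λ` satisfies
`⟨ξ, M_λ ξ⟩ ≥ (α∘ + √λ/(4π) − (n−1) e^{−√λ d}/(4π d)) ‖ξ‖²`. -/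
theorem stmt_0 {n : ℕ} (hn : 2 ≤ n)
    (y : Fin n → EuclideanSpace ℝ (Fin 3)) (hy : Function.Injective y)
    (α : Fin n → ℝ) (lam : ℝ) (hlam : 0 < lam)
    (α₀ d : ℝ)
    (hα₀ : IsLeast (Set.range α) α₀)
    (hd : IsLeast {r : ℝ | ∃ i j : Fin n, i ≠ j ∧ r = ‖y i - y j‖} d)
    (M : Matrix (Fin n) (Fin n) ℝ)
    (hM : ∀ i j : Fin n, M i j =
      if i = j then α i + Real.sqrt lam / (4 * Real.pi)
      else -(Real.exp (-(Real.sqrt lam * ‖y i - y j‖)) / (4 * Real.pi * ‖y i - y j‖)))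
    (ξ : Fin n → ℝ) :
    (α₀ + Real.sqrt lam / (4 * Real.pi)
        - ((n : ℝ) - 1) * Real.exp (-(Real.sqrt lam * d)) / (4 * Real.pi * d))
        * (∑ i, ξ i ^ 2)
      ≤ ξ ⬝ᵥ M.mulVec ξ := by
  have hd_pos : 0 < d := by
    obtain ⟨i, j, hij, rfl⟩ := hd.1
    exact norm_pos_iff.mpr (sub_ne_zero.mpr (hy.ne hij))
  have hdiag : ∀ i, α₀ + Real.sqrt lam / (4 * Real.pi) ≤ M i i := by
    intro i
    rw [hM, if_pos rfl]
    gcongr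
    exact hα₀.2 ⟨i, rfl⟩
  have hoff : ∀ i j, i ≠ j → |M i j| ≤ Real.exp (-(Real.sqrt lam * d)) / (4 * Real.pi * d) := by
    intro i j hij
    rw [hM, if_neg hij, abs_neg, abs_of_nonneg (by positivity)]
    exact exp_neg_mul_div_le_of_le (Real.sqrt_nonneg lam) hd_pos (hd.2 ⟨i, j, hij, rfl⟩)
  simpa only [Fintype.card_fin, mul_div_assoc] using
    Matrix.sub_card_sub_one_mul_sum_sq_le_dotProduct_mulVec hdiag hoff ξ
end

section
/- Let n ≥ 2, let y₁,…,yₙ ∈ ℝ³ be distinct points, let α ∈ ℝⁿ, and set α∘ := min_{1≤i≤n} αᵢ and d := min_{i≠j} ‖yᵢ−yⱼ‖. If 4π·α∘·d ≥ n−1, then for every λ > 0 the matrix M_λ is positive-definite, i.e. ⟨ξ, M_λ ξ⟩ > 0 for every nonzero ξ ∈ ℝⁿ. -/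
open Real Matrix

/-- A matrix whose diagonal entries are at least `(n - 1) c + s` and whose off-diagonal entries
are bounded by `c` in absolute value has quadratic form bounded below by `s ∑ ξᵢ²`. -/
theorem mul_sum_sq_le_dotProduct_mulVec {n : ℕ} (A : Matrix (Fin n) (Fin n) ℝ) (c s : ℝ)
    (hdiag : ∀ i, ((n : ℝ) - 1) * c + s ≤ A i i) (hoff : ∀ i j, i ≠ j → |A i j| ≤ c)
    (ξ : Fin n → ℝ) : s * ∑ i, ξ i ^ 2 ≤ ξ ⬝ᵥ A.mulVec ξ := by
  have hterm : ∀ i j, (if i = j then (n * c + s) * ξ i ^ 2 else 0)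
      - c / 2 * (ξ i ^ 2 + ξ j ^ 2) ≤ ξ i * (A i j * ξ j) := by
    intro i j
    split_ifs with hij
    · subst hij
      nlinarith [mul_le_mul_of_nonneg_right (hdiag i) (sq_nonneg (ξ i))]
    · obtain ⟨h₁, h₂⟩ := abs_le.mp (hoff i j hij)
      nlinarith [mul_nonneg (sub_nonneg.mpr h₂) (sq_nonneg (ξ i - ξ j)),
        mul_nonneg (neg_le_iff_add_nonneg.mp h₁) (sq_nonneg (ξ i + ξ j))]
  calc s * ∑ i, ξ i ^ 2
      = ∑ i, ∑ j, ((if i = j then (n * c + s) * ξ i ^ 2 else 0)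
          - c / 2 * (ξ i ^ 2 + ξ j ^ 2)) := by
        simp only [Finset.sum_sub_distrib, Finset.sum_ite_eq, Finset.mem_univ, if_true,
          ← Finset.mul_sum, Finset.sum_add_distrib, Finset.sum_const, Finset.card_univ,
          Fintype.card_fin, nsmul_eq_mul]
        ring
    _ ≤ ∑ i, ∑ j, ξ i * (A i j * ξ j) :=
        Finset.sum_le_sum fun i _ => Finset.sum_le_sum fun j _ => hterm i j
    _ = ξ ⬝ᵥ A.mulVec ξ := by
        simp only [dotProduct, mulVec, Finset.mul_sum]

/-- If `4π α∘ d ≥ n−1`, then for every `λ > 0` the matrix `M_λ` is positive-definite. -/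
theorem stmt_1 {n : ℕ} (hn : 2 ≤ n)
    (y : Fin n → EuclideanSpace ℝ (Fin 3)) (hy : Function.Injective y)
    (α : Fin n → ℝ)
    (α₀ d : ℝ)
    (hα₀ : IsLeast (Set.range α) α₀)
    (hd : IsLeast {r : ℝ | ∃ i j : Fin n, i ≠ j ∧ r = ‖y i - y j‖} d)
    (M : ℝ → Matrix (Fin n) (Fin n) ℝ)
    (hM : ∀ lam : ℝ, 0 < lam → ∀ i j : Fin n, M lam i j =
      if i = j then α i + Real.sqrt lam / (4 * Real.pi)
      else -(Real.exp (-(Real.sqrt lam * ‖y i - y j‖)) / (4 * Real.pi * ‖y i - y j‖)))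
    (h : (n : ℝ) - 1 ≤ 4 * Real.pi * α₀ * d) :
    ∀ lam : ℝ, 0 < lam → ∀ ξ : Fin n → ℝ, ξ ≠ 0 → 0 < ξ ⬝ᵥ (M lam).mulVec ξ := by
  intro lam hlam ξ hξ
  have hdpos : 0 < d := by
    obtain ⟨i, j, hij, rfl⟩ := hd.1
    exact norm_pos_iff.mpr (sub_ne_zero.mpr (hy.ne hij))
  have hs : 0 < √lam / (4 * π) := by positivity
  have hsum : 0 < ∑ i, ξ i ^ 2 := by
    obtain ⟨i, hi⟩ := Function.ne_iff.mp hξ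
    exact Finset.sum_pos' (fun j _ => sq_nonneg (ξ j)) ⟨i, Finset.mem_univ i, sq_pos_of_ne_zero hi⟩
  refine (mul_pos hs hsum).trans_le
    (mul_sum_sq_le_dotProduct_mulVec (M lam) (1 / (4 * π * d)) _ (fun i => ?_)
      (fun i j hij => ?_) ξ)
  · rw [hM lam hlam, if_pos rfl, mul_one_div]
    gcongr
    refine le_trans ?_ (hα₀.2 ⟨i, rfl⟩)
    rw [div_le_iff₀ (by positivity)]
    linarith
  · have hle : d ≤ ‖y i - y j‖ := hd.2 ⟨i, j, hij, rfl⟩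
    rw [hM lam hlam, if_neg hij, abs_neg, abs_of_nonneg (by positivity)]
    gcongr
    exact exp_le_one_iff.mpr (neg_nonpos.mpr (by positivity))
end

section
/- Let n ≥ 2, let y₁,…,yₙ ∈ ℝ³ be distinct points, let α ∈ ℝⁿ, and set α∘ := min_{1≤i≤n} αᵢ and d := min_{i≠j} ‖yᵢ−yⱼ‖. Assume 4π·α∘·d < n−1 and let λ∘ > 0 satisfy 4π·α∘·d + √λ∘·d = (n−1)·e^{−√λ∘·d}. Then for every λ > λ∘ the matrix M_λ is positive-definite. -/
open Real Matrix

/-- A real matrix whose diagonal entries are at least `a` and whose off-diagonal entries are bounded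
by `b` in absolute value has a positive quadratic form as soon as `(card ι - 1) * b < a`. -/
theorem dotProduct_mulVec_pos_of_diag_dominant {ι : Type*} [Fintype ι] [DecidableEq ι]
    (A : Matrix ι ι ℝ) (a b : ℝ) (hdiag : ∀ i, a ≤ A i i)
    (hoff : ∀ i j, i ≠ j → |A i j| ≤ b) (hab : ((Fintype.card ι : ℝ) - 1) * b < a)
    (ξ : ι → ℝ) (hξ : ξ ≠ 0) : 0 < ξ ⬝ᵥ A.mulVec ξ := by
  have hterm : ∀ i j, (if i = j then (a + b) * ξ i ^ 2 else 0) - b * ((ξ i ^ 2 + ξ j ^ 2) / 2)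
      ≤ ξ i * (A i j * ξ j) := by
    intro i j
    by_cases hij : i = j
    · subst hij
      rw [if_pos rfl]
      nlinarith [mul_le_mul_of_nonneg_right (hdiag i) (sq_nonneg (ξ i))]
    · rw [if_neg hij]
      obtain ⟨h₁, h₂⟩ := abs_le.mp (hoff i j hij)
      nlinarith [mul_nonneg (sub_nonneg.mpr h₂) (sq_nonneg (ξ i - ξ j)),
        mul_nonneg (neg_le_iff_add_nonneg.mp h₁) (sq_nonneg (ξ i + ξ j))]
  have hsum : ∑ i, ∑ j,
      ((if i = j then (a + b) * ξ i ^ 2 else 0) - b * ((ξ i ^ 2 + ξ j ^ 2) / 2))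
      = (a - ((Fintype.card ι : ℝ) - 1) * b) * ∑ i, ξ i ^ 2 := by
    simp only [Finset.sum_sub_distrib, Finset.sum_ite_eq, Finset.mem_univ, if_true,
      ← Finset.mul_sum, ← Finset.sum_div, Finset.sum_add_distrib, Finset.sum_const,
      Finset.card_univ, nsmul_eq_mul]
    ring
  have hpos : 0 < ∑ i, ξ i ^ 2 := by
    obtain ⟨k, hk⟩ := Function.ne_iff.mp hξ
    exact Finset.sum_pos' (fun i _ => sq_nonneg _) ⟨k, Finset.mem_univ k, sq_pos_of_ne_zero hk⟩
  calc 0 < (a - ((Fintype.card ι : ℝ) - 1) * b) * ∑ i, ξ i ^ 2 :=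
        mul_pos (sub_pos.mpr hab) hpos
    _ ≤ ∑ i, ∑ j, ξ i * (A i j * ξ j) := by
        rw [← hsum]
        exact Finset.sum_le_sum fun i _ => Finset.sum_le_sum fun j _ => hterm i j
    _ = ξ ⬝ᵥ A.mulVec ξ := by simp only [dotProduct, mulVec, Finset.mul_sum]

/-- If `4π α∘ d < n−1` and `λ∘ > 0` solves `4π α∘ d + √λ∘ d = (n−1) e^{−√λ∘ d}`, then for every
`λ > λ∘` the matrix `M_λ` is positive-definite. -/
theorem stmt_3 {n : ℕ} (hn : 2 ≤ n)
    (y : Fin n → EuclideanSpace ℝ (Fin 3)) (hy : Function.Injective y)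
    (α : Fin n → ℝ)
    (α₀ d : ℝ)
    (hα₀ : IsLeast (Set.range α) α₀)
    (hd : IsLeast {r : ℝ | ∃ i j : Fin n, i ≠ j ∧ r = ‖y i - y j‖} d)
    (M : ℝ → Matrix (Fin n) (Fin n) ℝ)
    (hM : ∀ lam : ℝ, 0 < lam → ∀ i j : Fin n, M lam i j =
      if i = j then α i + Real.sqrt lam / (4 * Real.pi)
      else -(Real.exp (-(Real.sqrt lam * ‖y i - y j‖)) / (4 * Real.pi * ‖y i - y j‖)))
    (h : 4 * Real.pi * α₀ * d < (n : ℝ) - 1)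
    (lam₀ : ℝ) (hlam₀ : 0 < lam₀)
    (heq : 4 * Real.pi * α₀ * d + Real.sqrt lam₀ * d
      = ((n : ℝ) - 1) * Real.exp (-(Real.sqrt lam₀ * d))) :
    ∀ lam : ℝ, lam₀ < lam → ∀ ξ : Fin n → ℝ, ξ ≠ 0 → 0 < ξ ⬝ᵥ (M lam).mulVec ξ := by
  intro lam hlam ξ hξ
  have hlam_pos : 0 < lam := hlam₀.trans hlam
  have hd_pos : 0 < d := by
    obtain ⟨i, j, hij, rfl⟩ := hd.1
    exact norm_sub_pos_iff.mpr (hy.ne hij)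
  have hn' : (2 : ℝ) ≤ n := by exact_mod_cast hn
  have hsqrt : √lam₀ < √lam := Real.sqrt_lt_sqrt hlam₀.le hlam
  refine dotProduct_mulVec_pos_of_diag_dominant (M lam) (α₀ + √lam / (4 * π))
    (Real.exp (-(√lam * d)) / (4 * π * d)) ?_ ?_ ?_ ξ hξ
  · intro i
    rw [hM lam hlam_pos, if_pos rfl]
    gcongr
    exact hα₀.2 ⟨i, rfl⟩
  · intro i j hij
    have hdij : d ≤ ‖y i - y j‖ := hd.2 ⟨i, j, hij, rfl⟩
    rw [hM lam hlam_pos, if_neg hij, abs_neg, abs_of_nonneg (by positivity)]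
    gcongr
  · have hmul : √lam₀ * d < √lam * d := mul_lt_mul_of_pos_right hsqrt hd_pos
    have hexp : Real.exp (-(√lam * d)) ≤ Real.exp (-(√lam₀ * d)) :=
      Real.exp_le_exp.mpr (neg_le_neg hmul.le)
    have hkey : ((n : ℝ) - 1) * Real.exp (-(√lam * d)) < 4 * π * α₀ * d + √lam * d := by
      have := mul_le_mul_of_nonneg_left hexp (by linarith : (0 : ℝ) ≤ n - 1)
      linarith
    rw [Fintype.card_fin, ← mul_div_assoc, div_lt_iff₀ (by positivity)]
    calc ((n : ℝ) - 1) * Real.exp (-(√lam * d)) < 4 * π * α₀ * d + √lam * d := hkey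
      _ = (α₀ + √lam / (4 * π)) * (4 * π * d) := by field_simp
end

section
/- Let λ > 0, let p₁,…,p_m ∈ ℝ³ be distinct points, and let D ⊆ ℝ³ \ {p₁,…,p_m} be a set whose closure contains a nonempty open set. If c₁,…,c_m ∈ ℝ satisfy Σ_{j=1}^{m} c_j · e^{−√λ‖x−p_j‖}/‖x−p_j‖ = 0 for every x ∈ D, then c_j = 0 for every j. -/
open Real

section YukawaKernel

open Filter Topology
open scoped ContDiff

variable {E : Type*} [NormedAddCommGroup E] [InnerProductSpace ℝ E]

theorem analyticAt_exp_neg_norm_div_norm (k : ℝ) {x q : E} (hx : x ≠ q) :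
    AnalyticAt ℝ (fun y => Real.exp (-(k * ‖y - q‖)) / ‖y - q‖) x := by
  have hsub : x - q ≠ 0 := sub_ne_zero.2 hx
  refine ContDiffAt.analyticAt (ContDiffAt.div ?_ ?_ (norm_ne_zero_iff.2 hsub))
  all_goals
    have hnorm : ContDiffAt ℝ ω (fun y => ‖y - q‖) x :=
      (contDiffAt_id.sub contDiffAt_const).norm ℝ hsub
  · exact (contDiffAt_const.mul hnorm).neg.exp
  · exact hnorm

theorem analyticOnNhd_sum_exp_neg_norm_div_norm {ι : Type*} [Fintype ι] (k : ℝ) (p : ι → E)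
    (c : ι → ℝ) :
    AnalyticOnNhd ℝ (fun x => ∑ j, c j * (Real.exp (-(k * ‖x - p j‖)) / ‖x - p j‖))
      (Set.range p)ᶜ := fun _ hx =>
  Finset.univ.analyticAt_fun_sum fun j _ => analyticAt_const.mul
    (analyticAt_exp_neg_norm_div_norm k fun hxj => hx ⟨j, hxj.symm⟩)

/-- A real-analytic function on the complement of a finite set in a space of dimension at least
two vanishes as soon as it vanishes on a somewhere dense set. -/
theorem AnalyticOnNhd.eqOn_zero_compl_of_subset_closure {f : E → ℝ} {s D U : Set E}
    (hrank : 1 < Module.rank ℝ E) (hs : s.Finite) (hf : AnalyticOnNhd ℝ f sᶜ)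
    (hfD : ∀ x ∈ D, f x = 0) (hUne : U.Nonempty) (hU : IsOpen U) (hUD : U ⊆ closure D) :
    Set.EqOn f 0 sᶜ := by
  have : Nontrivial E := (rank_pos_iff_nontrivial (R := ℝ)).1 (zero_lt_one.trans hrank)
  have hdense : Dense sᶜ := hs.countable.dense_compl ℝ
  obtain ⟨x₀, hx₀U, hx₀⟩ := hdense.inter_open_nonempty U hU hUne
  refine hf.eqOn_zero_of_preconnected_of_eventuallyEq_zero
    (hs.countable.isConnected_compl_of_one_lt_rank hrank).isPreconnected hx₀ ?_
  filter_upwards [hU.mem_nhds hx₀U, hs.isClosed.isOpen_compl.mem_nhds hx₀] with x hxU hx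
  have hfreq : ∃ᶠ y in 𝓝 x, f y = 0 := (mem_closure_iff_frequently.1 (hUD hxU)).mono hfD
  by_contra hne
  exact hfreq ((hf x hx).continuousAt.eventually_ne hne)

/-- The singularities of a linear combination of kernels determine its coefficients. -/
theorem eq_zero_of_eqOn_zero_sum_exp_neg_norm_div_norm {ι : Type*} [Fintype ι] [Nontrivial E]
    (k : ℝ) {p : ι → E} (hp : Function.Injective p) {c : ι → ℝ}
    (h : ∀ x ∉ Set.range p, ∑ j, c j * (Real.exp (-(k * ‖x - p j‖)) / ‖x - p j‖) = 0) (j : ι) :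
    c j = 0 := by
  classical
  have : (𝓝[≠] p j).NeBot := Module.punctured_nhds_neBot ℝ E (p j)
  let G : E → ℝ := fun x => c j * Real.exp (-(k * ‖x - p j‖)) +
    ‖x - p j‖ * ∑ i ∈ Finset.univ.erase j, c i * (Real.exp (-(k * ‖x - p i‖)) / ‖x - p i‖)
  have hcont : ContinuousAt G (p j) := by
    have hsum : ContinuousAt (fun x => ∑ i ∈ Finset.univ.erase j,
        c i * (Real.exp (-(k * ‖x - p i‖)) / ‖x - p i‖)) (p j) :=
      ((Finset.univ.erase j).analyticAt_fun_sum fun i hi => analyticAt_const.mul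
        (analyticAt_exp_neg_norm_div_norm k
          (hp.ne (Finset.ne_of_mem_erase hi).symm))).continuousAt
    have hnorm : ContinuousAt (fun x => ‖x - p j‖) (p j) := by fun_prop
    exact ContinuousAt.add (by fun_prop) (hnorm.mul hsum)
  have hzero : G =ᶠ[𝓝[≠] p j] 0 := by
    have hclosed : IsClosed (p '' {j}ᶜ) := (Set.toFinite _).isClosed
    have hnear : ∀ᶠ x in 𝓝 (p j), x ∉ p '' {j}ᶜ :=
      hclosed.isOpen_compl.mem_nhds fun ⟨i, hi, hij⟩ => hi (hp hij)
    filter_upwards [nhdsWithin_le_nhds hnear, self_mem_nhdsWithin] with x hx hxj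
    have hne : ‖x - p j‖ ≠ 0 := norm_ne_zero_iff.2 (sub_ne_zero.2 hxj)
    have hsum := h x (by
      rintro ⟨i, rfl⟩
      exact hx ⟨i, fun hij => hxj (congrArg p hij), rfl⟩)
    rw [← Finset.add_sum_erase _ _ (Finset.mem_univ j)] at hsum
    calc G x = ‖x - p j‖ * (c j * (Real.exp (-(k * ‖x - p j‖)) / ‖x - p j‖) +
          ∑ i ∈ Finset.univ.erase j, c i * (Real.exp (-(k * ‖x - p i‖)) / ‖x - p i‖)) := by
          simp only [G]
          field_simp
      _ = 0 := by rw [hsum, mul_zero]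
  have hlim : G (p j) = 0 := tendsto_nhds_unique
    (hcont.tendsto.mono_left nhdsWithin_le_nhds)
    (tendsto_const_nhds.congr' hzero.symm)
  simpa [G] using hlim

end YukawaKernel

/-- If a real linear combination of the kernels `x ↦ e^{−√λ‖x−pⱼ‖}/‖x−pⱼ‖` centered at distinct
points vanishes on a set `D ⊆ ℝ³ \ {p₁,…,p_m}` whose closure contains a nonempty open set, then
all coefficients vanish. -/
theorem stmt_5 {m : ℕ} (lam : ℝ) (hlam : 0 < lam)
    (p : Fin m → EuclideanSpace ℝ (Fin 3)) (hp : Function.Injective p)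
    (D : Set (EuclideanSpace ℝ (Fin 3))) (hD : D ⊆ (Set.range p)ᶜ)
    (hDopen : ∃ U : Set (EuclideanSpace ℝ (Fin 3)), U.Nonempty ∧ IsOpen U ∧ U ⊆ closure D)
    (c : Fin m → ℝ)
    (h : ∀ x ∈ D, ∑ j, c j * (Real.exp (-(Real.sqrt lam * ‖x - p j‖)) / ‖x - p j‖) = 0) :
    ∀ j, c j = 0 := by
  obtain ⟨U, hUne, hU, hUD⟩ := hDopen
  have hrank : 1 < Module.rank ℝ (EuclideanSpace ℝ (Fin 3)) := by
    rw [← Module.finrank_eq_rank, finrank_euclideanSpace_fin]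
    norm_num
  exact eq_zero_of_eqOn_zero_sum_exp_neg_norm_div_norm (Real.sqrt lam) hp
    ((analyticOnNhd_sum_exp_neg_norm_div_norm (Real.sqrt lam) p
      c).eqOn_zero_compl_of_subset_closure hrank (Set.finite_range p) h hUne hU hUD)
end

section
/- Let λ > 0, let y₁,…,yₙ ∈ ℝ³ be distinct points, fix an index i ∈ {1,…,n}, and let ξ ∈ ℝⁿ, η ∈ ℝ, v ∈ ℝ³. If for every x ∈ ℝ³ \ {y₁,…,yₙ} one has Σ_{j=1}^{n} ξ_j · e^{−√λ‖x−y_j‖}/‖x−y_j‖ = η · (√λ + 1/‖x−y_i‖) · (e^{−√λ‖x−y_i‖}/‖x−y_i‖) · ((x−y_i)/‖x−y_i‖)·v, then ξ = 0 and η·v = 0. -/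
open Real RealInnerProductSpace

open Filter Topology

section YukawaKernel

variable {E ι : Type*} [NormedAddCommGroup E] [NormedSpace ℝ E] [Fintype ι]

/-- Along a ray issuing from one of finitely many points, one eventually avoids all of them. -/
theorem eventually_add_smul_notMem_range {y : ι → E} (k : ι) {w : E} (hw : w ≠ 0) :
    ∀ᶠ t : ℝ in 𝓝[>] 0, y k + t • w ∉ Set.range y := by
  simp only [Set.mem_range, not_exists]
  refine eventually_all.2 fun j => ?_
  by_cases hj : y j = y k
  · filter_upwards [self_mem_nhdsWithin] with t ht
    rw [hj, left_eq_add]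
    exact smul_ne_zero (ne_of_gt ht) hw
  · have hc : Tendsto (fun t : ℝ => y k + t • w) (𝓝[>] 0) (𝓝 (y k)) := by
      have : Continuous fun t : ℝ => y k + t • w := by fun_prop
      simpa using (this.tendsto 0).mono_left nhdsWithin_le_nhds
    filter_upwards [hc.eventually_ne (Ne.symm hj)] with t ht using ht.symm

/-- Along a ray issuing from `y k`, a combination of the kernels `e^{-s‖x - y j‖} / ‖x - y j‖`
multiplied by the distance to `y k` tends to the `k`-th coefficient. -/
theorem tendsto_mul_sum_exp_neg_div_norm {y : ι → E} (hy : Function.Injective y) (ξ : ι → ℝ)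
    (s : ℝ) (k : ι) {w : E} (hw : ‖w‖ = 1) :
    Tendsto (fun t : ℝ => t * ∑ j, ξ j *
      (Real.exp (-(s * ‖y k + t • w - y j‖)) / ‖y k + t • w - y j‖)) (𝓝[>] 0) (𝓝 (ξ k)) := by
  classical
  have hsum : ξ k = ∑ j, if j = k then ξ k else 0 := by simp
  rw [hsum]
  simp only [Finset.mul_sum]
  refine tendsto_finsetSum _ fun j _ => ?_
  split_ifs with hj
  · subst hj
    have hc : Tendsto (fun t : ℝ => ξ j * Real.exp (-(s * t))) (𝓝[>] 0) (𝓝 (ξ j)) := by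
      have : Continuous fun t : ℝ => ξ j * Real.exp (-(s * t)) := by fun_prop
      simpa using (this.tendsto 0).mono_left nhdsWithin_le_nhds
    refine hc.congr' ?_
    filter_upwards [self_mem_nhdsWithin] with t (ht : 0 < t)
    rw [add_sub_cancel_left, norm_smul, hw, mul_one, Real.norm_of_nonneg ht.le]
    field_simp
  · have hne : ‖y k + (0 : ℝ) • w - y j‖ ≠ 0 := by
      rw [zero_smul, add_zero, norm_ne_zero_iff, sub_ne_zero]
      exact fun e => hj (hy e.symm)
    have hc : ContinuousAt (fun t : ℝ => t * (ξ j *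
        (Real.exp (-(s * ‖y k + t • w - y j‖)) / ‖y k + t • w - y j‖))) 0 := by
      fun_prop (disch := assumption)
    simpa using hc.tendsto.mono_left nhdsWithin_le_nhds

end YukawaKernel

/-- If a linear combination of the kernels centered at distinct `y₁,…,yₙ` coincides, away from the
points `yⱼ`, with `η` times the directional derivative (in direction `v`) of the kernel centered
at `y_i`, then `ξ = 0` and `η·v = 0`. -/
theorem stmt_7 {n : ℕ} (lam : ℝ) (hlam : 0 < lam)
    (y : Fin n → EuclideanSpace ℝ (Fin 3)) (hy : Function.Injective y)
    (i : Fin n) (ξ : Fin n → ℝ) (η : ℝ) (v : EuclideanSpace ℝ (Fin 3))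
    (h : ∀ x : EuclideanSpace ℝ (Fin 3), x ∉ Set.range y →
      ∑ j, ξ j * (Real.exp (-(Real.sqrt lam * ‖x - y j‖)) / ‖x - y j‖)
        = η * (Real.sqrt lam + 1 / ‖x - y i‖)
            * (Real.exp (-(Real.sqrt lam * ‖x - y i‖)) / ‖x - y i‖)
            * (⟪x - y i, v⟫ / ‖x - y i‖)) :
    (∀ j, ξ j = 0) ∧ η • v = 0 := by
  have hv : η • v = 0 := by
    by_cases hv0 : v = 0
    · simp [hv0]
    have hvn : ‖v‖ ≠ 0 := norm_ne_zero_iff.2 hv0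
    set w := ‖v‖⁻¹ • v with hw_def
    have hw : ‖w‖ = 1 := norm_smul_inv_norm hv0
    have hwv : ⟪w, v⟫ = ‖v‖ := by
      rw [hw_def, real_inner_smul_left, real_inner_self_eq_norm_sq]
      field_simp
    have hw0 : w ≠ 0 := norm_ne_zero_iff.1 (by simp [hw])
    have hid : Tendsto (fun t : ℝ => t) (𝓝[>] 0) (𝓝 0) := nhdsWithin_le_nhds
    have hl := hid.mul (tendsto_mul_sum_exp_neg_div_norm hy ξ (Real.sqrt lam) i hw)
    rw [zero_mul] at hl
    have hr : Tendsto (fun t : ℝ =>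
        η * (Real.sqrt lam * t + 1) * Real.exp (-(Real.sqrt lam * t)) * ‖v‖)
        (𝓝[>] 0) (𝓝 (η * ‖v‖)) := by
      have : Continuous fun t : ℝ =>
        η * (Real.sqrt lam * t + 1) * Real.exp (-(Real.sqrt lam * t)) * ‖v‖ := by fun_prop
      simpa using (this.tendsto 0).mono_left nhdsWithin_le_nhds
    have heq : η * ‖v‖ = 0 := by
      refine tendsto_nhds_unique (hr.congr' ?_) hl
      filter_upwards [self_mem_nhdsWithin, eventually_add_smul_notMem_range (y := y) i hw0]
        with t (ht : 0 < t) hmem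
      rw [h _ hmem, add_sub_cancel_left, norm_smul, hw, mul_one, Real.norm_of_nonneg ht.le,
        real_inner_smul_left, hwv]
      field_simp
    simp [(mul_eq_zero.1 heq).resolve_right hvn]
  refine ⟨fun k => ?_, hv⟩
  obtain ⟨w, hw⟩ := exists_norm_eq (EuclideanSpace ℝ (Fin 3)) zero_le_one
  have hw0 : w ≠ 0 := norm_ne_zero_iff.1 (by simp [hw])
  refine tendsto_nhds_unique (tendsto_mul_sum_exp_neg_div_norm hy ξ (Real.sqrt lam) k hw)
    (tendsto_const_nhds.congr' ?_)
  filter_upwards [eventually_add_smul_notMem_range (y := y) k hw0] with t hmem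
  rw [h _ hmem]
  rcases smul_eq_zero.1 hv with h0 | h0 <;> simp [h0]
end

section
/- Let λ > 0, let K ⊂ ℝ³ be compact, let Y = {y₁,…,yₙ} ⊂ K consist of n distinct points, and let D = {x_k : k ∈ ℕ} ⊆ K \ Y be a countable set of distinct points whose closure contains a nonempty open set. Then there exists N∘ ≥ 1 such that for every N ≥ N∘ and every z ∈ K \ D: z ∈ Y if and only if φ_λ^N(z) lies in the range of Φ_λ^N. -/
open Real Matrix

open Filter Topology

/-- The Yukawa kernel `exp (-μ‖v‖) / ‖v‖`. -/
noncomputable def yukawa {E : Type*} [NormedAddCommGroup E] (μ : ℝ) (v : E) : ℝ :=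
  Real.exp (-(μ * ‖v‖)) / ‖v‖

section Kernel

variable {E : Type*} [NormedAddCommGroup E] [InnerProductSpace ℝ E]

theorem analyticAt_yukawa [FiniteDimensional ℝ E] (μ : ℝ) {v : E} (hv : v ≠ 0) :
    AnalyticAt ℝ (yukawa μ) v := by
  have hn : AnalyticAt ℝ (fun w : E => ‖w‖) v := (contDiffAt_norm ℝ hv).analyticAt
  have he : AnalyticAt ℝ (fun w : E => Real.exp (-(μ * ‖w‖))) v :=
    ((analyticAt_const.mul hn).neg).rexp
  exact he.div hn (norm_ne_zero_iff.2 hv)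

theorem hasDerivAt_yukawa_radial (μ : ℝ) {t : ℝ} (ht : t ≠ 0) :
    HasDerivAt (fun s : ℝ => Real.exp (-(μ * s)) / s)
      (-((μ * t + 1) * Real.exp (-(μ * t))) / t ^ 2) t := by
  have h1 : HasDerivAt (fun s : ℝ => -(μ * s)) (-(μ * 1)) t :=
    ((hasDerivAt_id t).const_mul μ).neg
  refine (h1.exp.div (hasDerivAt_id t) ht).congr_deriv ?_
  simp only [id]
  ring

theorem fderiv_yukawa_smul [FiniteDimensional ℝ E] (μ : ℝ) {e : E} (he : ‖e‖ = 1) {t : ℝ}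
    (ht : 0 < t) :
    fderiv ℝ (yukawa μ) (t • e) e = -((μ * t + 1) * Real.exp (-(μ * t))) / t ^ 2 := by
  have he0 : e ≠ 0 := by
    rintro rfl
    simp at he
  have hd : HasFDerivAt (yukawa μ) (fderiv ℝ (yukawa μ) (t • e)) (t • e) :=
    (analyticAt_yukawa μ (smul_ne_zero ht.ne' he0)).differentiableAt.hasFDerivAt
  have hl : HasDerivAt (fun s : ℝ => s • e) e t := by
    simpa using (hasDerivAt_id t).smul_const e
  refine (hd.comp_hasDerivAt t hl).unique
    ((hasDerivAt_yukawa_radial μ ht.ne').congr_of_eventuallyEq ?_)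
  filter_upwards [lt_mem_nhds ht] with s hs
  simp [yukawa, norm_smul, he, abs_of_pos hs]

theorem tendsto_sq_mul_fderiv_yukawa [FiniteDimensional ℝ E] (μ : ℝ) {e : E} (he : ‖e‖ = 1) :
    Tendsto (fun t : ℝ => t ^ 2 * fderiv ℝ (yukawa μ) (t • e) e) (𝓝[>] 0) (𝓝 (-1)) := by
  have h : Tendsto (fun t : ℝ => -((μ * t + 1) * Real.exp (-(μ * t)))) (𝓝[>] 0) (𝓝 (-1)) := by
    refine tendsto_nhdsWithin_of_tendsto_nhds ?_
    have hc : Continuous fun t : ℝ => -((μ * t + 1) * Real.exp (-(μ * t))) := by fun_prop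
    simpa using hc.tendsto 0
  refine h.congr' ?_
  filter_upwards [self_mem_nhdsWithin] with t ht
  have ht : 0 < t := ht
  rw [fderiv_yukawa_smul μ he ht]
  field_simp

theorem tendsto_mul_yukawa_self (μ : ℝ) {e : E} (he : ‖e‖ = 1) :
    Tendsto (fun t : ℝ => t * yukawa μ (t • e)) (𝓝[>] 0) (𝓝 1) := by
  have h : Tendsto (fun t : ℝ => Real.exp (-(μ * t))) (𝓝[>] 0) (𝓝 1) := by
    refine tendsto_nhdsWithin_of_tendsto_nhds ?_
    have hc : Continuous fun t : ℝ => Real.exp (-(μ * t)) := by fun_prop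
    simpa using hc.tendsto 0
  refine h.congr' ?_
  filter_upwards [self_mem_nhdsWithin] with t ht
  have ht : 0 < t := ht
  simp only [yukawa, norm_smul, he, Real.norm_eq_abs, abs_of_pos ht, mul_one]
  field_simp

theorem tendsto_mul_yukawa_of_ne [FiniteDimensional ℝ E] (μ : ℝ) {e p : E} (hp : p ≠ 0) :
    Tendsto (fun t : ℝ => t * yukawa μ (p + t • e)) (𝓝[>] 0) (𝓝 0) := by
  refine tendsto_nhdsWithin_of_tendsto_nhds ?_
  have hl : Tendsto (fun t : ℝ => p + t • e) (𝓝 0) (𝓝 p) := by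
    have hc : Continuous fun t : ℝ => p + t • e := by fun_prop
    simpa using hc.tendsto 0
  simpa using tendsto_id.mul ((analyticAt_yukawa μ hp).continuousAt.tendsto.comp hl)

theorem tendsto_mul_sum_yukawa [FiniteDimensional ℝ E] {ι : Type*} [Fintype ι] (μ : ℝ)
    {e : E} (he : ‖e‖ = 1) {p : ι → E} (hp : Function.Injective p) (c : ι → ℝ) (i : ι) :
    Tendsto (fun t : ℝ => t * ∑ j, c j * yukawa μ (p i + t • e - p j)) (𝓝[>] 0) (𝓝 (c i)) := by
  classical
  have h : Tendsto (fun t : ℝ => ∑ j, c j * (t * yukawa μ (p i + t • e - p j))) (𝓝[>] 0)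
      (𝓝 (∑ j, c j * if j = i then 1 else 0)) := by
    refine tendsto_finsetSum _ fun j _ => Tendsto.const_mul _ ?_
    split_ifs with hj
    · subst hj
      simpa using tendsto_mul_yukawa_self μ he
    · have := tendsto_mul_yukawa_of_ne μ (e := e) (sub_ne_zero.2 (hp.ne (Ne.symm hj)))
      refine this.congr fun t => ?_
      rw [sub_add_eq_add_sub]
  simp only [mul_ite, mul_one, mul_zero, Finset.sum_ite_eq', Finset.mem_univ, if_true] at h
  refine h.congr fun t => ?_
  rw [Finset.mul_sum]
  exact Finset.sum_congr rfl fun j _ => by ring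

/-- Finitely many Yukawa monopoles together with one dipole are linearly independent. -/
theorem yukawa_coeff_eq_zero [FiniteDimensional ℝ E] {ι : Type*} [Fintype ι] (μ : ℝ)
    {e : E} (he : ‖e‖ = 1) {p : ι → E} (hp : Function.Injective p) (i : ι) (α : ℝ) (c : ι → ℝ)
    (h : ∀ v ∉ Set.range p,
      α * fderiv ℝ (yukawa μ) (v - p i) e + ∑ j, c j * yukawa μ (v - p j) = 0) :
    α = 0 ∧ c = 0 := by
  have hmem (j : ι) : ∀ᶠ t : ℝ in 𝓝[>] 0, p j + t • e ∉ Set.range p := by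
    have he0 : e ≠ 0 := by
      rintro rfl
      simp at he
    have hfin : ((fun t : ℝ => p j + t • e) ⁻¹' Set.range p).Finite :=
      (Set.finite_range p).preimage
        ((add_right_injective _).comp (smul_left_injective ℝ he0)).injOn
    have h0 : ∀ᶠ t in 𝓝[≠] (0 : ℝ), t ∉ (fun t : ℝ => p j + t • e) ⁻¹' Set.range p := by
      have hf := hfin.subset (Set.sdiff_subset (t := {0}))
      have := hf.isClosed.isOpen_compl.mem_nhds (x := (0 : ℝ)) (by simp)
      filter_upwards [mem_nhdsWithin_of_mem_nhds this, self_mem_nhdsWithin] with t h1 h2 h3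
      exact h1 ⟨h3, h2⟩
    exact h0.filter_mono (nhdsWithin_mono _ fun t ht => ne_of_gt ht)
  have hα : α = 0 := by
    have h1 := (tendsto_sq_mul_fderiv_yukawa μ he).const_mul α
    have hid : Tendsto (fun t : ℝ => t) (𝓝[>] 0) (𝓝 0) :=
      tendsto_nhdsWithin_of_tendsto_nhds tendsto_id
    have h2 := hid.mul (tendsto_mul_sum_yukawa μ he hp c i)
    have h3 : Tendsto (fun _ : ℝ => (0 : ℝ)) (𝓝[>] 0) (𝓝 (α * -1 + 0 * c i)) := by
      refine (h1.add h2).congr' ?_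
      filter_upwards [hmem i] with t ht
      have := h _ ht
      rw [add_sub_cancel_left] at this
      linear_combination t ^ 2 * this
    have := tendsto_nhds_unique h3 tendsto_const_nhds
    linarith
  refine ⟨hα, funext fun j => ?_⟩
  refine tendsto_nhds_unique (tendsto_mul_sum_yukawa μ he hp c j)
    (tendsto_const_nhds.congr' ?_)
  filter_upwards [hmem j] with t ht
  have := h _ ht
  rw [hα, zero_mul, zero_add] at this
  rw [this, mul_zero]
  rfl

theorem yukawa_coeff_eq_zero_of_dense [FiniteDimensional ℝ E] (hE : 1 < Module.rank ℝ E)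
    {ι : Type*} [Fintype ι] (μ : ℝ)
    {e : E} (he : ‖e‖ = 1) {p : ι → E} (hp : Function.Injective p) (i : ι) (α : ℝ) (c : ι → ℝ)
    {D U : Set E} (hU : U.Nonempty) (hUo : IsOpen U) (hUD : U ⊆ closure D)
    (h : ∀ v ∈ D, v ∉ Set.range p →
      α * fderiv ℝ (yukawa μ) (v - p i) e + ∑ j, c j * yukawa μ (v - p j) = 0) :
    α = 0 ∧ c = 0 := by
  set F : E → ℝ := fun v =>
    α * fderiv ℝ (yukawa μ) (v - p i) e + ∑ j, c j * yukawa μ (v - p j)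
  have hfin := Set.finite_range p
  have hopen : IsOpen (Set.range p)ᶜ := hfin.isClosed.isOpen_compl
  have hsub (v : E) (hv : v ∈ (Set.range p)ᶜ) (j : ι) : v - p j ≠ 0 :=
    sub_ne_zero.2 fun hj => hv ⟨j, hj.symm⟩
  have han : AnalyticOnNhd ℝ F (Set.range p)ᶜ := by
    intro v hv
    have hs (j : ι) : AnalyticAt ℝ (fun w : E => w - p j) v := analyticAt_id.sub analyticAt_const
    have h1 : AnalyticAt ℝ (fun w => fderiv ℝ (yukawa μ) (w - p i)) v :=
      AnalyticAt.fun_comp (analyticAt_yukawa μ (hsub v hv i)).fderiv (hs i)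
    have h2 : AnalyticAt ℝ (fun w => fderiv ℝ (yukawa μ) (w - p i) e) v :=
      ((ContinuousLinearMap.apply ℝ ℝ e).analyticAt _).fun_comp h1
    have h3 : AnalyticAt ℝ (fun w => ∑ j, c j * yukawa μ (w - p j)) v :=
      Finset.analyticAt_fun_sum _ fun j _ =>
        analyticAt_const.mul (AnalyticAt.fun_comp (analyticAt_yukawa μ (hsub v hv j)) (hs j))
    exact (analyticAt_const.mul h2).add h3
  have hzero : ∀ v ∈ U, v ∉ Set.range p → F v = 0 := by
    intro v hvU hv
    by_contra hne
    have hev : ∀ᶠ w in 𝓝 v, F w ≠ 0 := (han v hv).continuousAt.eventually_ne hne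
    obtain ⟨w, hwD, hw, hwp⟩ :=
      ((mem_closure_iff_frequently.1 (hUD hvU)).and_eventually
        (hev.and (hopen.mem_nhds hv))).exists
    exact hw (h w hwD hwp)
  have : Nontrivial E := ⟨e, 0, by rintro rfl; simp at he⟩
  obtain ⟨v₀, hv₀U, hv₀⟩ := (hfin.countable.dense_compl ℝ).inter_open_nonempty U hUo hU
  have hconn : IsPreconnected (Set.range p)ᶜ :=
    (hfin.countable.isConnected_compl_of_one_lt_rank hE).isPreconnected
  have hall := han.eqOn_zero_of_preconnected_of_eventuallyEq_zero hconn hv₀ (by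
    filter_upwards [hUo.mem_nhds hv₀U, hopen.mem_nhds hv₀] with v h1 h2
    exact hzero v h1 h2)
  exact yukawa_coeff_eq_zero μ he hp i α c fun v hv => hall hv

theorem tendsto_yukawa_slope [FiniteDimensional ℝ E] (μ : ℝ) {u v e : E} (huv : u ≠ v)
    {z : ℕ → E} (hz : Tendsto z atTop (𝓝 v))
    (he : Tendsto (fun m => ‖z m - v‖⁻¹ • (z m - v)) atTop (𝓝 e)) :
    Tendsto (fun m => (yukawa μ (u - z m) - yukawa μ (u - v)) / ‖z m - v‖) atTop
      (𝓝 (-(fderiv ℝ (yukawa μ) (u - v) e))) := by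
  have hd : HasFDerivAt (fun w => yukawa μ (u - w)) (-(fderiv ℝ (yukawa μ) (u - v))) v := by
    have h1 : HasFDerivAt (yukawa μ) (fderiv ℝ (yukawa μ) (u - v)) (u - v) :=
      (analyticAt_yukawa μ (sub_ne_zero.2 huv)).differentiableAt.hasFDerivAt
    have h2 : HasFDerivAt (fun w : E => u - w) (-(ContinuousLinearMap.id ℝ E)) v :=
      (hasFDerivAt_id v).const_sub u
    have h3 := h1.comp v h2
    rwa [ContinuousLinearMap.comp_neg, ContinuousLinearMap.comp_id] at h3
  have hd0 : Tendsto (fun m => z m - v) atTop (𝓝 0) := tendsto_sub_nhds_zero_iff.2 hz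
  refine ((hasFDerivWithinAt_univ.2 hd).lim hd0 (.of_forall fun _ => Set.mem_univ _) he).congr
    fun m => ?_
  rw [add_sub_cancel, smul_eq_mul, div_eq_inv_mul]

end Kernel

/-- After normalization, nontrivial linear relations between converging families subconverge to
a nontrivial linear relation between the limits. -/
theorem exists_ne_zero_limit_relation {κ β : Type*} [Fintype κ] (A : Set β)
    (f : ℕ → κ → β → ℝ) (g : κ → β → ℝ) (w : ℕ → κ → ℝ) (hw : ∀ m, w m ≠ 0)
    (hfg : ∀ b ∈ A, ∀ o, Tendsto (fun m => f m o b) atTop (𝓝 (g o b)))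
    (hrel : ∀ b ∈ A, ∀ᶠ m in atTop, ∑ o, w m o * f m o b = 0) :
    ∃ c : κ → ℝ, c ≠ 0 ∧ ∀ b ∈ A, ∑ o, c o * g o b = 0 := by
  have hmem (m : ℕ) : ‖w m‖⁻¹ • w m ∈ Metric.sphere (0 : κ → ℝ) 1 := by
    rw [mem_sphere_zero_iff_norm, norm_smul, norm_inv, norm_norm,
      inv_mul_cancel₀ (norm_ne_zero_iff.2 (hw m))]
  obtain ⟨c, hc, φ, hφ, hlim⟩ := (isCompact_sphere (0 : κ → ℝ) 1).tendsto_subseq hmem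
  refine ⟨c, ne_zero_of_mem_unit_sphere ⟨c, hc⟩, fun b hb => ?_⟩
  have hsum : Tendsto (fun m => ∑ o, (‖w (φ m)‖⁻¹ • w (φ m)) o * f (φ m) o b) atTop
      (𝓝 (∑ o, c o * g o b)) :=
    tendsto_finsetSum _ fun o _ =>
      (tendsto_pi_nhds.1 hlim o).mul ((hfg b hb o).comp hφ.tendsto_atTop)
  refine tendsto_nhds_unique hsum (tendsto_const_nhds.congr' ?_)
  filter_upwards [hφ.tendsto_atTop.eventually (hrel b hb)] with m hm
  simp only [Pi.smul_apply, smul_eq_mul, mul_assoc]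
  rw [← Finset.mul_sum, hm, mul_zero]

/-- Along a sequence of sources `z m` in a compact set avoiding the points `y j`, the fields of the
`z m` cannot eventually agree, at every point of a somewhere dense set, with linear combinations of
the fields of the `y j`. -/
theorem not_eventually_yukawa_eq_sum {E : Type*} [NormedAddCommGroup E] [InnerProductSpace ℝ E]
    [FiniteDimensional ℝ E] (hE : 1 < Module.rank ℝ E) {ι : Type*} [Fintype ι] (μ : ℝ)
    {K D U : Set E} (hK : IsCompact K) {y : ι → E} (hy : Function.Injective y)
    (hU : U.Nonempty) (hUo : IsOpen U) (hUD : U ⊆ closure D)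
    (z : ℕ → E) (hzK : ∀ m, z m ∈ K) (hzy : ∀ m, z m ∉ Set.range y) (a : ℕ → ι → ℝ) :
    ¬ ∀ v ∈ D, ∀ᶠ m in atTop, yukawa μ (v - z m) = ∑ j, a m j * yukawa μ (v - y j) := by
  classical
  intro hrel
  obtain ⟨z₀, -, φ, hφ, hz₀⟩ := hK.tendsto_subseq hzK
  replace hrel : ∀ v ∈ D, ∀ᶠ m in atTop,
      yukawa μ (v - z (φ m)) = ∑ j, a (φ m) j * yukawa μ (v - y j) :=
    fun v hv => hφ.tendsto_atTop.eventually (hrel v hv)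
  by_cases hz₀y : z₀ ∈ Set.range y
  · obtain ⟨i, rfl⟩ := hz₀y
    have hne (m : ℕ) : z (φ m) - y i ≠ 0 := sub_ne_zero.2 fun h => hzy (φ m) ⟨i, h.symm⟩
    have hmem (m : ℕ) : ‖z (φ m) - y i‖⁻¹ • (z (φ m) - y i) ∈ Metric.sphere (0 : E) 1 := by
      rw [mem_sphere_zero_iff_norm, norm_smul, norm_inv, norm_norm,
        inv_mul_cancel₀ (norm_ne_zero_iff.2 (hne m))]
    obtain ⟨e, he, ψ, hψ, hlim⟩ := (isCompact_sphere (0 : E) 1).tendsto_subseq hmem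
    obtain ⟨c, hc, hc0⟩ := exists_ne_zero_limit_relation (κ := Option ι) (D \ Set.range y)
      (fun m o v => o.elim
        ((yukawa μ (v - z (φ (ψ m))) - yukawa μ (v - y i)) / ‖z (φ (ψ m)) - y i‖)
        fun j => yukawa μ (v - y j))
      (fun o v => o.elim (-(fderiv ℝ (yukawa μ) (v - y i) e)) fun j => yukawa μ (v - y j))
      (fun m o => o.elim ‖z (φ (ψ m)) - y i‖
        fun j => (if j = i then 1 else 0) - a (φ (ψ m)) j)
      (fun m h => norm_ne_zero_iff.2 (hne (ψ m)) (congrFun h none))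
      (by
        rintro v ⟨-, hv⟩ (_ | j)
        · exact tendsto_yukawa_slope μ (fun h => hv ⟨i, h.symm⟩)
            (hz₀.comp hψ.tendsto_atTop) hlim
        · exact tendsto_const_nhds)
      (by
        rintro v ⟨hv, -⟩
        filter_upwards [hψ.tendsto_atTop.eventually (hrel v hv)] with m hm
        simp only [Fintype.sum_option, Option.elim_none, Option.elim_some, sub_mul,
          Finset.sum_sub_distrib, ite_mul, one_mul, zero_mul, Finset.sum_ite_eq',
          Finset.mem_univ, if_true]
        rw [mul_div_cancel₀ _ (norm_ne_zero_iff.2 (hne (ψ m))), hm]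
        ring)
    obtain ⟨h1, h2⟩ := yukawa_coeff_eq_zero_of_dense hE μ (mem_sphere_zero_iff_norm.1 he) hy i
      (-c none) (fun j => c (some j)) hU hUo hUD (fun v hv hvy => by
        simpa [Fintype.sum_option] using hc0 v ⟨hv, hvy⟩)
    refine hc (funext fun o => ?_)
    rcases o with _ | j
    · exact neg_eq_zero.1 h1
    · exact congrFun h2 j
  · have hp : Function.Injective fun o : Option ι => o.elim z₀ y := by
      rintro (_ | j) (_ | k) h
      · rfl
      · exact absurd ⟨k, h.symm⟩ hz₀y
      · exact absurd ⟨j, h⟩ hz₀y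
      · exact congrArg some (hy h)
    obtain ⟨c, hc, hc0⟩ := exists_ne_zero_limit_relation (κ := Option ι)
      (D \ Set.range fun o : Option ι => o.elim z₀ y)
      (fun m o v => yukawa μ (v - o.elim (z (φ m)) y))
      (fun o v => yukawa μ (v - o.elim z₀ y))
      (fun m o => o.elim 1 fun j => -a (φ m) j)
      (fun m h => one_ne_zero (congrFun h none))
      (by
        rintro v ⟨-, hv⟩ (_ | j)
        · have hne : v - z₀ ≠ 0 := sub_ne_zero.2 fun h => hv ⟨none, h.symm⟩
          exact (analyticAt_yukawa μ hne).continuousAt.tendsto.comp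
            (tendsto_const_nhds.sub hz₀)
        · exact tendsto_const_nhds)
      (by
        rintro v ⟨hv, -⟩
        filter_upwards [hrel v hv] with m hm
        simp [Fintype.sum_option, hm])
    have : Nontrivial E := rank_pos_iff_nontrivial.1 (zero_lt_one.trans hE)
    obtain ⟨e, he⟩ := exists_norm_eq E zero_le_one
    refine hc (yukawa_coeff_eq_zero_of_dense hE μ he hp none 0 c hU hUo hUD
      fun v hv hvp => ?_).2
    rw [zero_mul, zero_add]
    exact hc0 v ⟨hv, hvp⟩

/-- For `N` large enough, a point `z ∈ K \ D` belongs to `Y = {y₁,…,yₙ}` if and only if the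
vector `φ_λ^N(z)` belongs to the range of the matrix `Φ_λ^N`. -/
theorem stmt_8 {n : ℕ} (lam : ℝ) (hlam : 0 < lam)
    (K : Set (EuclideanSpace ℝ (Fin 3))) (hK : IsCompact K)
    (y : Fin n → EuclideanSpace ℝ (Fin 3)) (hy : Function.Injective y)
    (hyK : Set.range y ⊆ K)
    (x : ℕ → EuclideanSpace ℝ (Fin 3)) (hx : Function.Injective x)
    (hxK : Set.range x ⊆ K \ Set.range y)
    (hDopen : ∃ U : Set (EuclideanSpace ℝ (Fin 3)),
      U.Nonempty ∧ IsOpen U ∧ U ⊆ closure (Set.range x)) :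
    ∃ N₀ : ℕ, 1 ≤ N₀ ∧ ∀ N, N₀ ≤ N → ∀ z ∈ K \ Set.range x,
      (z ∈ Set.range y ↔
        (fun k : Fin N => Real.exp (-(Real.sqrt lam * ‖x k - z‖)) / ‖x k - z‖)
          ∈ Set.range (Matrix.of fun (k : Fin N) (j : Fin n) =>
              Real.exp (-(Real.sqrt lam * ‖x k - y j‖)) / ‖x k - y j‖).mulVec) := by
  obtain ⟨U, hU, hUo, hUD⟩ := hDopen
  by_contra! hcon
  have hseq (m : ℕ) : ∃ (z : EuclideanSpace ℝ (Fin 3)) (a : Fin n → ℝ), z ∈ K ∧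
      z ∉ Set.range y ∧ ∀ k < m, yukawa (Real.sqrt lam) (x k - z) =
        ∑ j, a j * yukawa (Real.sqrt lam) (x k - y j) := by
    obtain ⟨N, hN, z, hz, h⟩ := hcon (m + 1) (Nat.le_add_left 1 m)
    rcases h with ⟨⟨j, rfl⟩, h⟩ | ⟨hzy, a, ha⟩
    · refine absurd ⟨Pi.single j 1, ?_⟩ h
      ext k
      simp
    · refine ⟨z, a, hz.1, hzy, fun k hk => ?_⟩
      have := congrFun ha ⟨k, by omega⟩
      simp only [Matrix.mulVec, dotProduct, Matrix.of_apply] at this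
      simp only [yukawa, ← this]
      exact Finset.sum_congr rfl fun j _ => mul_comm _ _
  choose z a hzK hzy hrel using hseq
  refine not_eventually_yukawa_eq_sum ?_ (Real.sqrt lam) hK hy hU hUo hUD z hzK hzy a ?_
  · rw [← Module.finrank_eq_rank, finrank_euclideanSpace_fin]
    norm_num
  · rintro _ ⟨k, rfl⟩
    filter_upwards [eventually_gt_atTop k] with m hm
    exact hrel m k hm
end

section
/- Let E be a real Banach space, let c : [0,∞) → E be continuous, and set S(t) := ∫₀ᵗ c(s) ds. For each τ ∈ (0,1], let χ_τ : (0,∞) → ℝ be integrable with χ_τ ≥ 0 almost everywhere and ∫₀^∞ χ_τ(s) ds = 1, and assume lim_{τ→0⁺} ∫₀^∞ s·χ_τ(s) ds = 0. Then for every t > 0, lim_{τ→0⁺} ‖ S(t) − ∫₀ᵗ S(t−s)·χ_τ(s) ds ‖ = 0. -/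
open MeasureTheory Filter Set

/-- Averaging the primitive of `c` against a probability density on `(0, ∞)` changes its value
at `t` by at most `sup ‖c‖` times the first moment of the density. -/
theorem norm_integral_sub_integral_smul_le {E : Type*} [NormedAddCommGroup E] [NormedSpace ℝ E]
    [CompleteSpace E] {c : ℝ → E} (hc : Continuous c) {f : ℝ → ℝ}
    (hf : IntegrableOn f (Set.Ioi 0))
    (hf0 : ∀ᵐ s ∂(volume.restrict (Set.Ioi (0 : ℝ))), 0 ≤ f s)
    (hf1 : ∫ s in Set.Ioi (0 : ℝ), f s = 1)
    (hfm : IntegrableOn (fun s => s * f s) (Set.Ioi 0))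
    {t M : ℝ} (ht : 0 < t) (hM : ∀ s ∈ Set.Icc 0 t, ‖c s‖ ≤ M) :
    ‖(∫ s in (0 : ℝ)..t, c s) - ∫ s in (0 : ℝ)..t, f s • (∫ r in (0 : ℝ)..(t - s), c r)‖
      ≤ M * ∫ s in Set.Ioi (0 : ℝ), s * f s := by
  have hM0 : 0 ≤ M := (norm_nonneg _).trans (hM 0 ⟨le_rfl, ht.le⟩)
  have hbound : ∀ a b, 0 ≤ a → a ≤ b → b ≤ t → ‖∫ r in a..b, c r‖ ≤ M * (b - a) := by
    intro a b ha hab hb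
    refine (intervalIntegral.norm_integral_le_of_norm_le_const fun r hr => ?_).trans_eq
      (by rw [abs_of_nonneg (sub_nonneg.2 hab)])
    rw [Set.uIoc_of_le hab] at hr
    exact hM r ⟨ha.trans hr.1.le, hr.2.trans hb⟩
  set F : ℝ → E := fun s => ∫ r in (0 : ℝ)..max (t - s) 0, c r with hF
  have hFc : Continuous F :=
    (intervalIntegral.continuous_primitive (fun a b => hc.intervalIntegrable a b) 0).comp
      (by fun_prop)
  have hFb : ∀ᵐ s ∂(volume.restrict (Set.Ioi (0 : ℝ))), ‖F s‖ ≤ M * t := by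
    filter_upwards [ae_restrict_mem measurableSet_Ioi] with s hs
    have hs : 0 < s := hs
    have hle : max (t - s) 0 ≤ t := max_le (by linarith) ht.le
    refine (hbound 0 _ le_rfl (le_max_right _ _) hle).trans ?_
    rw [sub_zero]
    gcongr
  have hfF : IntegrableOn (fun s => f s • F s) (Set.Ioi 0) := by
    refine (hf.norm.mul_const (M * t)).mono' (hf.aestronglyMeasurable.smul
      hFc.aestronglyMeasurable) ?_
    filter_upwards [hFb] with s hs
    rw [norm_smul]
    gcongr
  have hconv : ∫ s in (0 : ℝ)..t, f s • (∫ r in (0 : ℝ)..(t - s), c r)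
      = ∫ s in Set.Ioi (0 : ℝ), f s • F s := by
    rw [intervalIntegral.integral_of_le ht.le, setIntegral_eq_of_subset_of_forall_sdiff_eq_zero
      measurableSet_Ioi (Set.Ioc_subset_Ioi_self (a := t) (b := (0 : ℝ)))]
    · refine setIntegral_congr_fun measurableSet_Ioc fun s hs => ?_
      simp only [hF, max_eq_left (sub_nonneg.2 hs.2)]
    · intro s hs
      have hts : t < s := by
        by_contra! h
        exact hs.2 ⟨hs.1, h⟩
      simp [hF, max_eq_right (sub_nonpos.2 hts.le)]
  have hconst : (∫ s in (0 : ℝ)..t, c s)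
      = ∫ s in Set.Ioi (0 : ℝ), f s • (∫ r in (0 : ℝ)..t, c r) := by
    rw [integral_smul_const, hf1, one_smul]
  rw [hconv, hconst, ← integral_sub (hf.smul_const _) hfF, ← integral_const_mul]
  refine norm_integral_le_of_norm_le (hfm.const_mul M) ?_
  filter_upwards [hf0, ae_restrict_mem measurableSet_Ioi] with s hs0 hs
  have hs : 0 < s := hs
  have hle : max (t - s) 0 ≤ t := max_le (by linarith) ht.le
  rw [← smul_sub, intervalIntegral.integral_interval_sub_left (hc.intervalIntegrable _ _)
    (hc.intervalIntegrable _ _), norm_smul, Real.norm_of_nonneg hs0]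
  calc f s * ‖∫ r in max (t - s) 0..t, c r‖ ≤ f s * (M * s) := by
        gcongr
        refine (hbound _ t (le_max_right _ _) hle le_rfl).trans ?_
        gcongr
        linarith [le_max_left (t - s) 0]
    _ = M * (s * f s) := by ring

/-- Sharp-pulse limit: if `S(t) = ∫₀ᵗ c(s) ds` and the `χ_τ` are approximations of the Dirac
delta at `t = 0`, then `∫₀ᵗ S(t−s) χ_τ(s) ds → S(t)` as `τ → 0⁺`, for every `t > 0`. -/
theorem stmt_13 {E : Type*} [NormedAddCommGroup E] [NormedSpace ℝ E] [CompleteSpace E]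
    (c : ℝ → E) (hc : ContinuousOn c (Set.Ici 0))
    (χ : ℝ → ℝ → ℝ)
    (hint : ∀ τ ∈ Set.Ioc (0 : ℝ) 1, IntegrableOn (χ τ) (Set.Ioi 0))
    (hpos : ∀ τ ∈ Set.Ioc (0 : ℝ) 1,
      ∀ᵐ s ∂(volume.restrict (Set.Ioi (0 : ℝ))), 0 ≤ χ τ s)
    (hone : ∀ τ ∈ Set.Ioc (0 : ℝ) 1, ∫ s in Set.Ioi (0 : ℝ), χ τ s = 1)
    (hmom_int : ∀ τ ∈ Set.Ioc (0 : ℝ) 1,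
      IntegrableOn (fun s => s * χ τ s) (Set.Ioi 0))
    (hmom : Tendsto (fun τ => ∫ s in Set.Ioi (0 : ℝ), s * χ τ s)
      (nhdsWithin 0 (Set.Ioc (0 : ℝ) 1)) (nhds 0)) :
    ∀ t : ℝ, 0 < t →
      Tendsto (fun τ =>
          ‖(∫ s in (0 : ℝ)..t, c s)
            - ∫ s in (0 : ℝ)..t, χ τ s • (∫ r in (0 : ℝ)..(t - s), c r)‖)
        (nhdsWithin 0 (Set.Ioc (0 : ℝ) 1)) (nhds 0) := by
  intro t ht
  set c' : ℝ → E := fun s => c (max s 0) with hc'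
  have hcc : Continuous c' :=
    hc.comp_continuous (by fun_prop) fun s => le_max_right s 0
  have hprim : ∀ b, 0 ≤ b → ∫ r in (0 : ℝ)..b, c r = ∫ r in (0 : ℝ)..b, c' r := by
    intro b hb
    refine intervalIntegral.integral_congr fun r hr => ?_
    rw [Set.uIcc_of_le hb] at hr
    simp only [hc', max_eq_left hr.1]
  obtain ⟨M, hM⟩ := isCompact_Icc.exists_bound_of_continuousOn (hcc.continuousOn (s := Set.Icc 0 t))
  have hlim : Tendsto (fun τ => M * ∫ s in Set.Ioi (0 : ℝ), s * χ τ s)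
      (nhdsWithin 0 (Set.Ioc (0 : ℝ) 1)) (nhds 0) := by
    simpa using hmom.const_mul M
  refine squeeze_zero' (Eventually.of_forall fun _ => norm_nonneg _) ?_ hlim
  filter_upwards [self_mem_nhdsWithin] with τ hτ
  have hconv : ∫ s in (0 : ℝ)..t, χ τ s • (∫ r in (0 : ℝ)..(t - s), c r)
      = ∫ s in (0 : ℝ)..t, χ τ s • (∫ r in (0 : ℝ)..(t - s), c' r) := by
    refine intervalIntegral.integral_congr fun s hs => ?_
    rw [Set.uIcc_of_le ht.le] at hs
    simp only [hprim (t - s) (sub_nonneg.2 hs.2)]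
  rw [hprim t ht.le, hconv]
  exact norm_integral_sub_integral_smul_le hcc (hint τ hτ) (hpos τ hτ) (hone τ hτ)
    (hmom_int τ hτ) ht hM
end
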